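/- There is an absolute constant C > 0 such that for every positive integer f and every weighted graph G on n vertices, there exists an f-EFT 5-emulator H of G with |E(H)| ≤ C·(n^{4/3} + n^{6/5}·f^{3/5} + n·f). -/

import Mathlib

open SimpleGraph
open scoped ENNReal

noncomputable section

/-- Weighted distance in a graph: the infimum, over all walks from `u` to `v`,
of the total weight of the walk's edges (`⊤` if there is no walk). -/
def wdist {V : Type} (G : SimpleGraph V) (w : Sym2 V → ℝ≥0∞) (u v : V) : ℝ≥0∞ :=
  ⨅ p : G.Walk u v, (p.edges.map w).sum

/-- Distance in a graph `H` whose edge `(x, y)` is (re)weighted to `δ x y`. -/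
def emulDist {V : Type} (H : SimpleGraph V) (δ : V → V → ℝ≥0∞) (u v : V) : ℝ≥0∞ :=
  ⨅ p : H.Walk u v, (p.darts.map (fun d => δ d.toProd.1 d.toProd.2)).sum

/-- `H` is an `f`-edge-fault-tolerant `t`-emulator of the weighted graph `(G, w)`:
for every fault set `F ⊆ E(G)` with `|F| ≤ f`, the graph `H` with every edge `(x,y)`
reweighted to `dist_{G∖F}(x,y)` approximates all distances of `G ∖ F` within factor `t`. -/
def IsEFTEmulator {V : Type} (G : SimpleGraph V) (w : Sym2 V → ℝ≥0∞)
    (H : SimpleGraph V) (f : ℕ) (t : ℝ≥0∞) : Prop :=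
  ∀ F : Finset (Sym2 V), ↑F ⊆ G.edgeSet → F.card ≤ f →
    ∀ u v : V,
      wdist (G.deleteEdges ↑F) w u v ≤ emulDist H (wdist (G.deleteEdges ↑F) w) u v ∧
      emulDist H (wdist (G.deleteEdges ↑F) w) u v ≤ t * wdist (G.deleteEdges ↑F) w u v

/-- `e` is the last edge of the list `l` in the order given by the ranking `π`. -/
def IsLastEdge {V : Type} (π : Sym2 V → ℕ) (l : List (Sym2 V)) (e : Sym2 V) : Prop :=
  e ∈ l ∧ ∀ e' ∈ l, π e' ≤ π e

/-- The cycle `p` is blocked by the unordered pair `b` of edges: both members of `b`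
lie on `p` and one of them is the last edge of `p` in the order `π`. -/
def CycleBlockedBy {V : Type} {H : SimpleGraph V} (π : Sym2 V → ℕ) {u : V}
    (p : H.Walk u u) (b : Sym2 (Sym2 V)) : Prop :=
  ∃ e1 e2 : Sym2 V, b = s(e1, e2) ∧ e1 ∈ p.edges ∧ e2 ∈ p.edges ∧ IsLastEdge π p.edges e1

/-- `B` is a `2k` double-blocking set for `H` with edge order `π`: it consists of
unordered pairs of distinct edges of `H`, every cycle with at most `2k` edges is blocked
by a member of `B`, and every cycle with at most `k+1` edges is blocked by two
distinct members of `B`. -/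
def IsDoubleBlockingSet {V : Type} (H : SimpleGraph V) (π : Sym2 V → ℕ) (k : ℕ)
    (B : Finset (Sym2 (Sym2 V))) : Prop :=
  (∀ b ∈ B, ¬ b.IsDiag ∧ ∀ e ∈ b, e ∈ H.edgeSet) ∧
  (∀ (u : V) (p : H.Walk u u), p.IsCycle → p.length ≤ 2 * k →
      ∃ b ∈ B, CycleBlockedBy π p b) ∧
  (∀ (u : V) (p : H.Walk u u), p.IsCycle → p.length ≤ k + 1 →
      ∃ b1 ∈ B, ∃ b2 ∈ B, b1 ≠ b2 ∧ CycleBlockedBy π p b1 ∧ CycleBlockedBy π p b2)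

/-- The number of pairs of `B` containing the edge `e`. -/
def edgeBlockCount {V : Type} (B : Finset (Sym2 (Sym2 V))) (e : Sym2 V) : ℕ :=
  {b ∈ (B : Set (Sym2 (Sym2 V))) | e ∈ b}.ncard

/-- The `i`-th edge of the vertex sequence `v`. -/
def edgeOf {V : Type} {k : ℕ} (v : Fin (k + 1) → V) (i : Fin k) : Sym2 V :=
  s(v i.castSucc, v i.succ)

/-- The average degree `2|E(H)|/n` of a graph on `n` vertices. -/
def avgDeg {V : Type} [Fintype V] (H : SimpleGraph V) : ℝ :=
  2 * (H.edgeSet.ncard : ℝ) / (Fintype.card V : ℝ)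

end
noncomputable section

/-- `v` is a SCUM `k`-path (for odd `k`), viewed as an oriented sequence of `k+1`
distinct pairwise-adjacent vertices: it is simple, its middle edge (the edge with
0-indexed position `(k-1)/2`, i.e. the index `j` with `2j+1 = k`) is the last edge
of the path in the order `π`, and the two oriented subpaths starting from the middle
edge and going towards either endpoint are chain-unblocked with respect to `B`. -/
def IsSCUM {V : Type} (H : SimpleGraph V) (π : Sym2 V → ℕ) (B : Finset (Sym2 (Sym2 V)))
    (k : ℕ) (v : Fin (k + 1) → V) : Prop :=
  Function.Injective v ∧
  (∀ i : Fin k, H.Adj (v i.castSucc) (v i.succ)) ∧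
  (∀ i j : Fin k, 2 * (j : ℕ) + 1 = k → π (edgeOf v i) ≤ π (edgeOf v j)) ∧
  (∀ (i : Fin k) (j : Fin (k + 1)), 2 * (i : ℕ) + 1 ≤ k → (j : ℕ) + 1 ≤ (i : ℕ) →
      ∀ e' : Sym2 V, s(edgeOf v i, e') ∈ B → v j ∉ e') ∧
  (∀ (i : Fin k) (j : Fin (k + 1)), k ≤ 2 * (i : ℕ) + 1 → (i : ℕ) + 2 ≤ (j : ℕ) →
      ∀ e' : Sym2 V, s(edgeOf v i, e') ∈ B → v j ∉ e')

/-- The number of (oriented) SCUM `k`-paths of `H`. -/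
def scumCount {V : Type} (H : SimpleGraph V) (π : Sym2 V → ℕ)
    (B : Finset (Sym2 (Sym2 V))) (k : ℕ) : ℕ :=
  {v : Fin (k + 1) → V | IsSCUM H π B k v}.ncard

/-- The number of (oriented, aligned) SCUM `k`-path meets of `H`: pairs of distinct
SCUM `k`-paths sharing both endpoints. -/
def scumMeetCount {V : Type} (H : SimpleGraph V) (π : Sym2 V → ℕ)
    (B : Finset (Sym2 (Sym2 V))) (k : ℕ) : ℕ :=
  {vv : (Fin (k + 1) → V) × (Fin (k + 1) → V) |
    IsSCUM H π B k vv.1 ∧ IsSCUM H π B k vv.2 ∧ vv.1 ≠ vv.2 ∧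
    vv.1 0 = vv.2 0 ∧ vv.1 (Fin.last k) = vv.2 (Fin.last k)}.ncard

/-- The oriented path given by the vertex sequence `a` is chain-unblocked with
respect to `B`: for any edge `e` of the path and any vertex `x` strictly following
`e` along the path, no pair `{e, e'} ∈ B` has `e'` incident on `x`. -/
def ChainUnblockedSeq {V : Type} (B : Finset (Sym2 (Sym2 V))) {L : ℕ}
    (a : Fin (L + 1) → V) : Prop :=
  ∀ (i : Fin L) (j : Fin (L + 1)), (i : ℕ) + 2 ≤ (j : ℕ) →
    ∀ e' : Sym2 V, s(edgeOf a i, e') ∈ B → a j ∉ e'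

/-- The walk `p` is blocked: some pair of `B` has both its edges on `p`. -/
def PathBlocked {V : Type} {H : SimpleGraph V} (B : Finset (Sym2 (Sym2 V)))
    {u v : V} (p : H.Walk u v) : Prop :=
  ∃ b ∈ B, ∀ e ∈ b, e ∈ p.edges

/-- The walk `p` is double-blocked: two distinct pairs of `B` have both their edges on `p`. -/
def PathDoubleBlocked {V : Type} {H : SimpleGraph V} (B : Finset (Sym2 (Sym2 V)))
    {u v : V} (p : H.Walk u v) : Prop :=
  ∃ b1 ∈ B, ∃ b2 ∈ B, b1 ≠ b2 ∧ (∀ e ∈ b1, e ∈ p.edges) ∧ (∀ e ∈ b2, e ∈ p.edges)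

/-- The subgraph of `H` consisting of the edge `e` together with all edges
preceding it in the order `π`. -/
def subEdges {V : Type} (H : SimpleGraph V) (π : Sym2 V → ℕ) (e : Sym2 V) : SimpleGraph V :=
  SimpleGraph.fromEdgeSet {e' ∈ H.edgeSet | π e' ≤ π e}

/-- `e` is a core edge of `H` (with respect to edge order `π` and degree threshold `d/4`):
`e` survives in the graph obtained from the subgraph of edges up to `e` by iteratively
deleting vertices of degree at most `d/4`; equivalently, there is a set `S` of vertices
containing both endpoints of `e` on which the subgraph of edges up to `e` induces
a graph of minimum degree greater than `d/4`. -/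
def IsCoreEdge {V : Type} (H : SimpleGraph V) (π : Sym2 V → ℕ) (d : ℝ) (e : Sym2 V) : Prop :=
  e ∈ H.edgeSet ∧
  ∃ S : Set V, (∀ x ∈ e, x ∈ S) ∧
    ∀ v ∈ S, d / 4 < ({u ∈ S | (subEdges H π e).Adj v u}.ncard : ℝ)

end

section Distances

variable {V : Type} {G H H' : SimpleGraph V} {w : Sym2 V → ℝ≥0∞} {δ : V → V → ℝ≥0∞}

lemma wdist_self (u : V) : wdist G w u u = 0 :=
  le_antisymm (iInf_le_of_le Walk.nil (by simp)) bot_le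

lemma wdist_comm (u v : V) : wdist G w u v = wdist G w v u := by
  have key : ∀ u v : V, wdist G w u v ≤ wdist G w v u := fun u v =>
    le_iInf fun p => iInf_le_of_le p.reverse (by simp [Walk.edges_reverse, List.sum_reverse])
  exact le_antisymm (key u v) (key v u)

lemma wdist_triangle (u v x : V) : wdist G w u x ≤ wdist G w u v + wdist G w v x := by
  refine ENNReal.le_iInf_add_iInf fun p q => iInf_le_of_le (p.append q) ?_
  simp [Walk.edges_append]

lemma wdist_le_of_adj {u v : V} (h : G.Adj u v) : wdist G w u v ≤ w s(u, v) :=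
  iInf_le_of_le h.toWalk (by simp [Adj.toWalk])

lemma emulDist_self (u : V) : emulDist H δ u u = 0 :=
  le_antisymm (iInf_le_of_le Walk.nil (by simp)) bot_le

lemma emulDist_triangle (u v x : V) :
    emulDist H δ u x ≤ emulDist H δ u v + emulDist H δ v x := by
  refine ENNReal.le_iInf_add_iInf fun p q => iInf_le_of_le (p.append q) ?_
  simp [Walk.darts_append]

lemma emulDist_le_of_adj {u v : V} (h : H.Adj u v) : emulDist H δ u v ≤ δ u v :=
  iInf_le_of_le h.toWalk (by simp [Adj.toWalk])

lemma emulDist_comm (hδ : ∀ u v, δ u v = δ v u) (u v : V) :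
    emulDist H δ u v = emulDist H δ v u := by
  have key : ∀ u v : V, emulDist H δ u v ≤ emulDist H δ v u := fun u v =>
    le_iInf fun p => iInf_le_of_le p.reverse (by
      simp only [Walk.darts_reverse, List.map_reverse, List.sum_reverse, List.map_map]
      refine le_of_eq (congrArg List.sum (List.map_congr_left fun d _ => ?_))
      simpa using hδ _ _)
  exact le_antisymm (key u v) (key v u)

lemma emulDist_anti (h : H ≤ H') (u v : V) : emulDist H' δ u v ≤ emulDist H δ u v := by
  refine le_iInf fun p => ?_
  induction p with
  | nil => simp [emulDist_self]
  | @cons _ y _ hadj p ih =>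
    refine (emulDist_triangle _ y _).trans ?_
    simpa using add_le_add (emulDist_le_of_adj (h hadj)) ih

lemma wdist_le_emulDist (u v : V) : wdist G w u v ≤ emulDist H (wdist G w) u v := by
  refine le_iInf fun p => ?_
  induction p with
  | nil => simp [wdist_self]
  | @cons _ y _ hadj p ih =>
    refine (wdist_triangle _ y _).trans ?_
    simpa using add_le_add le_rfl ih

lemma emulDist_le_mul_wdist {t : ℝ≥0∞} (ht : t ≠ ⊤) (ht0 : t ≠ 0)
    (h : ∀ x y, G.Adj x y → emulDist H δ x y ≤ t * w s(x, y)) (u v : V) :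
    emulDist H δ u v ≤ t * wdist G w u v := by
  rw [wdist, ENNReal.mul_iInf_of_ne ht0 ht]
  refine le_iInf fun p => ?_
  induction p with
  | nil => simp [emulDist_self]
  | @cons _ y _ hadj p ih =>
    refine (emulDist_triangle _ y _).trans ?_
    simpa [mul_add] using add_le_add (h _ _ hadj) ih

end Distances

section Greedy

variable {V : Type}

/-- The fault set `F` witnesses that the edge `e` of `G` is not yet `5`-spanned by `H`. -/
def IsFaultWitness (G : SimpleGraph V) (w : Sym2 V → ℝ≥0∞) (f : ℕ) (H : SimpleGraph V)
    (e : Sym2 V) (F : Finset (Sym2 V)) : Prop :=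
  ↑F ⊆ G.edgeSet ∧ F.card ≤ f ∧ e ∉ F ∧
    ∃ x y, e = s(x, y) ∧ 5 * w e < emulDist H (wdist (G.deleteEdges ↑F) w) x y

/-- The greedy emulator after the edges of rank less than `t` have been processed. -/
def greedyGraph (G : SimpleGraph V) (w : Sym2 V → ℝ≥0∞) (f : ℕ) (π : Sym2 V → ℕ) :
    ℕ → SimpleGraph V
  | 0 => ⊥
  | t + 1 => greedyGraph G w f π t ⊔ SimpleGraph.fromEdgeSet
      {e | e ∈ G.edgeSet ∧ π e = t ∧ ∃ F, IsFaultWitness G w f (greedyGraph G w f π t) e F}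

variable {G : SimpleGraph V} {w : Sym2 V → ℝ≥0∞} {f : ℕ} {π : Sym2 V → ℕ}

lemma greedyGraph_adj (t : ℕ) (x y : V) : (greedyGraph G w f π t).Adj x y ↔
    G.Adj x y ∧ π s(x, y) < t ∧
      ∃ F, IsFaultWitness G w f (greedyGraph G w f π (π s(x, y))) s(x, y) F := by
  induction t with
  | zero => simp [greedyGraph]
  | succ t ih =>
    simp only [greedyGraph, sup_adj, ih, fromEdgeSet_adj, Set.mem_ofPred_eq, mem_edgeSet]
    constructor
    · rintro (⟨h1, h2, h3⟩ | ⟨⟨h1, rfl, h3⟩, -⟩)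
      · exact ⟨h1, by omega, h3⟩
      · exact ⟨h1, by omega, h3⟩
    · rintro ⟨h1, h2, h3⟩
      rcases Nat.lt_succ_iff_lt_or_eq.mp h2 with h | rfl
      · exact Or.inl ⟨h1, h, h3⟩
      · exact Or.inr ⟨⟨h1, rfl, h3⟩, h1.ne⟩

/-- The output of the greedy algorithm. -/
def greedyEmulator (G : SimpleGraph V) (w : Sym2 V → ℝ≥0∞) (f : ℕ) (π : Sym2 V → ℕ) :
    SimpleGraph V :=
  ⨆ t, greedyGraph G w f π t

lemma greedyEmulator_adj (x y : V) : (greedyEmulator G w f π).Adj x y ↔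
    G.Adj x y ∧ ∃ F, IsFaultWitness G w f (greedyGraph G w f π (π s(x, y))) s(x, y) F := by
  simp only [greedyEmulator, iSup_adj, greedyGraph_adj]
  exact ⟨fun ⟨_, h1, _, h3⟩ => ⟨h1, h3⟩, fun ⟨h1, h3⟩ => ⟨_, h1, Nat.lt_succ_self _, h3⟩⟩

lemma greedyGraph_adj_of_lt {t : ℕ} {x y : V} (h : (greedyEmulator G w f π).Adj x y)
    (hlt : π s(x, y) < t) : (greedyGraph G w f π t).Adj x y := by
  rw [greedyEmulator_adj] at h
  exact (greedyGraph_adj _ _ _).2 ⟨h.1, hlt, h.2⟩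

lemma isEFTEmulator_greedyEmulator : IsEFTEmulator G w (greedyEmulator G w f π) f 5 := by
  intro F hFG hF u v
  refine ⟨wdist_le_emulDist u v, emulDist_le_mul_wdist (by simp) (by simp) ?_ u v⟩
  intro x y hxy
  by_cases h : (greedyEmulator G w f π).Adj x y
  · refine (emulDist_le_of_adj h).trans ((wdist_le_of_adj hxy).trans ?_)
    exact le_mul_of_one_le_left bot_le (by norm_num)
  · rw [deleteEdges_adj] at hxy
    refine (emulDist_anti (le_iSup (greedyGraph G w f π) (π s(x, y))) x y).trans ?_
    by_contra! hlt
    exact h ((greedyEmulator_adj x y).2 ⟨hxy.1, F, hFG, hF, by simpa using hxy.2, x, y, rfl, hlt⟩)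

end Greedy

section Blocking

variable {V : Type}

/-- Every edge `e` of `H` has a set `F e` of at most `f` edges which meets every cycle of length
at most `6` with last edge `e`, and meets it twice if its length is at most `4`. -/
structure IsBlocking (H : SimpleGraph V) (π : Sym2 V → ℕ) (F : Sym2 V → Finset (Sym2 V))
    (f : ℕ) : Prop where
  inj : Function.Injective π
  card_le : ∀ e, (F e).card ≤ f
  triangle : ∀ x y z, H.Adj x y → H.Adj y z → H.Adj z x →
    π s(y, z) < π s(x, y) → π s(z, x) < π s(x, y) → s(y, z) ∈ F s(x, y)
  square : ∀ x y z t, H.Adj x y → H.Adj y z → H.Adj z t → H.Adj t x →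
    π s(y, z) < π s(x, y) → π s(z, t) < π s(x, y) → π s(t, x) < π s(x, y) →
    (s(y, z) ∈ F s(x, y) ∨ s(z, t) ∈ F s(x, y)) ∧
    (s(y, z) ∈ F s(x, y) ∨ s(t, x) ∈ F s(x, y)) ∧
    (s(z, t) ∈ F s(x, y) ∨ s(t, x) ∈ F s(x, y))
  hexagon : ∀ x y z t r s, H.Adj x y → H.Adj y z → H.Adj z t → H.Adj t r → H.Adj r s →
    H.Adj s x → π s(y, z) < π s(x, y) → π s(z, t) < π s(x, y) → π s(t, r) < π s(x, y) →
    π s(r, s) < π s(x, y) → π s(s, x) < π s(x, y) →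
    s(y, z) ∈ F s(x, y) ∨ s(z, t) ∈ F s(x, y) ∨ s(t, r) ∈ F s(x, y) ∨
      s(r, s) ∈ F s(x, y) ∨ s(s, x) ∈ F s(x, y)

lemma exists_isBlocking_greedyEmulator {G : SimpleGraph V} {w : Sym2 V → ℝ≥0∞} {f : ℕ}
    {π : Sym2 V → ℕ} (hinj : Function.Injective π) (hmono : ∀ e e', π e < π e' → w e ≤ w e') :
    ∃ F, IsBlocking (greedyEmulator G w f π) π F f := by
  classical
  have hex : ∀ e : Sym2 V, ∃ F : Finset (Sym2 V), F.card ≤ f ∧ ∀ x y, e = s(x, y) →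
      (greedyEmulator G w f π).Adj x y → e ∉ F ∧
        5 * w e < emulDist (greedyGraph G w f π (π e)) (wdist (G.deleteEdges ↑F) w) x y := by
    intro e
    by_cases he : e ∈ (greedyEmulator G w f π).edgeSet
    · induction e with | _ a b
      rw [mem_edgeSet, greedyEmulator_adj] at he
      obtain ⟨-, F, -, hF, heF, x, y, hxy, hlt⟩ := he
      refine ⟨F, hF, fun x' y' h _ => ⟨heF, ?_⟩⟩
      rw [hxy, Sym2.eq_iff] at h
      rcases h with ⟨rfl, rfl⟩ | ⟨rfl, rfl⟩
      · exact hlt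
      · rwa [emulDist_comm wdist_comm]
    · refine ⟨∅, by simp, fun x y h hadj => ?_⟩
      subst h
      exact absurd hadj he
  choose F hcard hF using hex
  have hlt : ∀ x y, (greedyEmulator G w f π).Adj x y → 5 * w s(x, y) <
      emulDist (greedyGraph G w f π (π s(x, y)))
        (wdist (G.deleteEdges ↑(F s(x, y))) w) y x := by
    intro x y h
    rw [emulDist_comm wdist_comm]
    exact (hF _ x y rfl h).2
  have hself : ∀ x y, (greedyEmulator G w f π).Adj x y →
      wdist (G.deleteEdges ↑(F s(x, y))) w x y ≤ w s(x, y) := by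
    intro x y h
    refine wdist_le_of_adj ?_
    rw [deleteEdges_adj]
    exact ⟨((greedyEmulator_adj x y).1 h).1, by simpa using (hF _ x y rfl h).1⟩
  have hd : ∀ e x y, (greedyEmulator G w f π).Adj x y → π s(x, y) < π e → s(x, y) ∉ F e →
      wdist (G.deleteEdges ↑(F e)) w x y ≤ w e := by
    intro e x y h hπ hxy
    refine (wdist_le_of_adj ?_).trans (hmono _ _ hπ)
    rw [deleteEdges_adj]
    exact ⟨((greedyEmulator_adj x y).1 h).1, by simpa using hxy⟩
  have he : ∀ e x y, (greedyEmulator G w f π).Adj x y → π s(x, y) < π e →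
      emulDist (greedyGraph G w f π (π e)) (wdist (G.deleteEdges ↑(F e)) w) x y ≤
        wdist (G.deleteEdges ↑(F e)) w x y := fun e x y h hπ =>
    emulDist_le_of_adj (greedyGraph_adj_of_lt h hπ)
  refine ⟨F, hinj, hcard, ?_, ?_, ?_⟩
  · intro x y z hxy hyz hzx h1 h2
    by_contra hyzF
    refine (hlt x y hxy).not_ge ?_
    have hzx' : wdist (G.deleteEdges ↑(F s(x, y))) w z x ≤ w s(x, y) + w s(x, y) := by
      rw [wdist_comm]
      exact (wdist_triangle x y z).trans (add_le_add (hself x y hxy) (hd _ y z hyz h1 hyzF))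
    calc _ ≤ _ := emulDist_triangle y z x
      _ ≤ w s(x, y) + (w s(x, y) + w s(x, y)) := add_le_add
          ((he _ y z hyz h1).trans (hd _ y z hyz h1 hyzF)) ((he _ z x hzx h2).trans hzx')
      _ = 3 * w s(x, y) := by ring
      _ ≤ 5 * w s(x, y) := by gcongr; norm_num
  · intro x y z t hxy hyz hzt htx h1 h2 h3
    have four : emulDist (greedyGraph G w f π (π s(x, y)))
        (wdist (G.deleteEdges ↑(F s(x, y))) w) y x ≤
          wdist (G.deleteEdges ↑(F s(x, y))) w y z + (wdist (G.deleteEdges ↑(F s(x, y))) w z t +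
            wdist (G.deleteEdges ↑(F s(x, y))) w t x) := by
      refine (emulDist_triangle y z x).trans (add_le_add (he _ y z hyz h1) ?_)
      exact (emulDist_triangle z t x).trans (add_le_add (he _ z t hzt h2) (he _ t x htx h3))
    have sum5 : 5 * w s(x, y) =
        w s(x, y) + w s(x, y) + (w s(x, y) + w s(x, y) + w s(x, y)) := by ring
    refine ⟨?_, ?_, ?_⟩
    · by_contra! hn
      refine (hlt x y hxy).not_ge (four.trans ?_)
      have hyz' := hd _ y z hyz h1 hn.1
      have hzt' := hd _ z t hzt h2 hn.2
      have htx' : wdist (G.deleteEdges ↑(F s(x, y))) w t x ≤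
          w s(x, y) + w s(x, y) + w s(x, y) := by
        rw [wdist_comm]
        exact (wdist_triangle x z t).trans (add_le_add ((wdist_triangle x y z).trans
          (add_le_add (hself x y hxy) hyz')) hzt')
      rw [sum5, ← add_assoc]
      gcongr
    · by_contra! hn
      refine (hlt x y hxy).not_ge (four.trans ?_)
      have hyz' := hd _ y z hyz h1 hn.1
      have htx' := hd _ t x htx h3 hn.2
      have hzt' : wdist (G.deleteEdges ↑(F s(x, y))) w z t ≤
          w s(x, y) + w s(x, y) + w s(x, y) := by
        rw [wdist_comm]
        exact (wdist_triangle t y z).trans (add_le_add ((wdist_triangle t x y).trans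
          (add_le_add htx' (hself x y hxy))) hyz')
      rw [sum5, add_comm (wdist _ w z t), ← add_assoc]
      gcongr
    · by_contra! hn
      refine (hlt x y hxy).not_ge (four.trans ?_)
      have hzt' := hd _ z t hzt h2 hn.1
      have htx' := hd _ t x htx h3 hn.2
      have hyz' : wdist (G.deleteEdges ↑(F s(x, y))) w y z ≤
          w s(x, y) + w s(x, y) + w s(x, y) := by
        rw [wdist_comm]
        exact (wdist_triangle z x y).trans (add_le_add ((wdist_triangle z t x).trans
          (add_le_add hzt' htx')) (hself x y hxy))
      rw [sum5, add_comm (wdist _ w y z)]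
      gcongr
  · intro x y z t r s hxy hyz hzt htr hrs hsx h1 h2 h3 h4 h5
    by_contra! hn
    obtain ⟨n1, n2, n3, n4, n5⟩ := hn
    refine (hlt x y hxy).not_ge ?_
    calc _ ≤ w s(x, y) + (w s(x, y) + (w s(x, y) + (w s(x, y) + w s(x, y)))) := by
          refine (emulDist_triangle y z x).trans
            (add_le_add ((he _ y z hyz h1).trans (hd _ y z hyz h1 n1)) ?_)
          refine (emulDist_triangle z t x).trans
            (add_le_add ((he _ z t hzt h2).trans (hd _ z t hzt h2 n2)) ?_)
          refine (emulDist_triangle t r x).trans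
            (add_le_add ((he _ t r htr h3).trans (hd _ t r htr h3 n3)) ?_)
          exact (emulDist_triangle r s x).trans
            (add_le_add ((he _ r s hrs h4).trans (hd _ r s hrs h4 n4))
              ((he _ s x hsx h5).trans (hd _ s x hsx h5 n5)))
      _ = 5 * w s(x, y) := by ring

lemma exists_injective_rank [Finite V] (w : Sym2 V → ℝ≥0∞) :
    ∃ π : Sym2 V → ℕ, Function.Injective π ∧ ∀ e e', π e < π e' → w e ≤ w e' := by
  obtain ⟨n, ⟨φ⟩⟩ := Finite.exists_equiv_fin (Sym2 V)
  let σ := Tuple.sort (w ∘ φ.symm)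
  refine ⟨fun e => (σ.symm (φ e) : ℕ), fun e e' h => ?_, fun e e' h => ?_⟩
  · exact φ.injective (σ.symm.injective (Fin.ext h))
  · have := Tuple.monotone_sort (w ∘ φ.symm) (Fin.le_def.2 h.le)
    simpa [σ] using this

end Blocking
section Counting

lemma card_sq_le_card_mul_card_collisions {α β : Type*} [Fintype β] [DecidableEq β]
    (s : Finset α) (g : α → β) :
    s.card ^ 2 ≤ Fintype.card β * ((s ×ˢ s).filter fun p => g p.1 = g p.2).card := by
  have h1 : s.card = ∑ c : β, (s.filter fun a => g a = c).card :=
    Finset.card_eq_sum_card_fiberwise fun _ _ => Finset.mem_coe.2 (Finset.mem_univ _)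
  have h2 : ((s ×ˢ s).filter fun p => g p.1 = g p.2).card =
      ∑ c : β, (s.filter fun a => g a = c).card ^ 2 := by
    rw [Finset.card_eq_sum_card_fiberwise (f := fun p : α × α => g p.1) (t := Finset.univ)
      fun _ _ => Finset.mem_coe.2 (Finset.mem_univ _)]
    refine Finset.sum_congr rfl fun c _ => ?_
    rw [sq, ← Finset.card_product]
    congr 1
    ext ⟨a, b⟩
    simp only [Finset.mem_filter, Finset.mem_product]
    grind
  rw [h2, h1]
  exact sq_sum_le_card_mul_sum_sq

variable {V : Type} [Fintype V] [DecidableEq V]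

lemma card_pairs_le (S : Finset (Sym2 V)) :
    (Finset.univ.filter fun p : V × V => s(p.1, p.2) ∈ S).card ≤ 2 * S.card := by
  refine Finset.card_le_mul_card_image_of_maps_to (f := fun p : V × V => s(p.1, p.2))
    (by simp) 2 fun g _ => ?_
  induction g with | _ x y
  refine (Finset.card_le_card (t := {(x, y), (y, x)}) ?_).trans Finset.card_le_two
  rintro ⟨a, b⟩ h
  simpa [Sym2.eq_iff] using (Finset.mem_filter.1 h).2

/-- The vertices incident on an edge of `S`. -/
def endpoints (S : Finset (Sym2 V)) : Finset V :=
  (Finset.univ.filter fun p : V × V => s(p.1, p.2) ∈ S).image Prod.fst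

lemma mem_endpoints {S : Finset (Sym2 V)} {a : V} : a ∈ endpoints S ↔ ∃ b, s(a, b) ∈ S := by
  simp [endpoints]

lemma card_endpoints_le (S : Finset (Sym2 V)) : (endpoints S).card ≤ 2 * S.card :=
  Finset.card_image_le.trans (card_pairs_le S)

variable {H : SimpleGraph V} [DecidableRel H.Adj] {π : Sym2 V → ℕ}
  {F : Sym2 V → Finset (Sym2 V)} {f : ℕ}

omit [Fintype V] [DecidableEq V] [DecidableRel H.Adj] in
lemma IsBlocking.exists_opposite_mem (hB : IsBlocking H π F f) {x y i j : V}
    (hxi : H.Adj x i) (hyi : H.Adj y i) (hxj : H.Adj x j) (hyj : H.Adj y j)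
    (h1 : π s(y, i) < π s(x, i)) (h2 : π s(x, j) < π s(x, i)) (h3 : π s(y, j) < π s(x, i)) :
    ∃ k, s(j, k) ∈ F s(x, i) := by
  rw [Sym2.eq_swap] at h1 h2
  rcases (hB.square x i y j hxi hyi.symm hyj hxj.symm h1 h3 h2).2.2 with h | h
  · exact ⟨y, by rwa [Sym2.eq_swap (a := j)]⟩
  · exact ⟨x, h⟩

omit [DecidableRel H.Adj] in
lemma IsBlocking.mem_endpoints_or (hB : IsBlocking H π F f) {x y i j : V}
    (hxi : H.Adj x i) (hyi : H.Adj y i) (hxj : H.Adj x j) (hyj : H.Adj y j)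
    (hxy : x ≠ y) (hij : i ≠ j) :
    j ∈ endpoints (F s(x, i)) ∪ endpoints (F s(y, i)) ∨
      i ∈ endpoints (F s(x, j)) ∪ endpoints (F s(y, j)) := by
  have hne : ∀ {a b c d : V}, (a ≠ c ∨ b ≠ d) → (a ≠ d ∨ b ≠ c) → π s(a, b) ≠ π s(c, d) := by
    intro a b c d h1 h2 h
    rcases Sym2.eq_iff.1 (hB.inj h) with ⟨rfl, rfl⟩ | ⟨rfl, rfl⟩
    · simp at h1
    · simp at h2
  have d1 := hne (a := x) (b := i) (c := y) (d := i) (.inl hxy) (.inr hyi.ne')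
  have d2 := hne (a := x) (b := i) (c := x) (d := j) (.inr hij) (.inl hxj.ne)
  have d3 := hne (a := x) (b := i) (c := y) (d := j) (.inl hxy) (.inl hxj.ne)
  have d4 := hne (a := y) (b := i) (c := x) (d := j) (.inl hxy.symm) (.inl hyj.ne)
  have d5 := hne (a := y) (b := i) (c := y) (d := j) (.inr hij) (.inl hyj.ne)
  have d6 := hne (a := x) (b := j) (c := y) (d := j) (.inl hxy) (.inr hyj.ne')
  have m1 := hB.exists_opposite_mem hxi hyi hxj hyj
  have m2 := hB.exists_opposite_mem hyi hxi hyj hxj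
  have m3 := hB.exists_opposite_mem hxj hyj hxi hyi
  have m4 := hB.exists_opposite_mem hyj hxj hyi hxi
  simp only [Finset.mem_union, mem_endpoints]
  rcases lt_or_gt_of_ne d1 with c1 | c1 <;> rcases lt_or_gt_of_ne d6 with c2 | c2
  · rcases lt_or_gt_of_ne d5 with c3 | c3
    · exact .inr (.inr (m4 c2 c3 (c1.trans c3)))
    · exact .inl (.inr (m2 c1 c3 (c2.trans c3)))
  · rcases lt_or_gt_of_ne d4 with c3 | c3
    · exact .inr (.inl (m3 c2 (c1.trans c3) c3))
    · exact .inl (.inr (m2 c1 (c2.trans c3) c3))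
  · rcases lt_or_gt_of_ne d3 with c3 | c3
    · exact .inr (.inr (m4 c2 (c1.trans c3) c3))
    · exact .inl (.inl (m1 c1 (c2.trans c3) c3))
  · rcases lt_or_gt_of_ne d2 with c3 | c3
    · exact .inr (.inl (m3 c2 c3 (c1.trans c3)))
    · exact .inl (.inl (m1 c1 c3 (c2.trans c3)))

/-- The set of common neighbors of `x` and `y`. -/
def coNbrs (H : SimpleGraph V) [DecidableRel H.Adj] (x y : V) : Finset V :=
  Finset.univ.filter fun a => H.Adj x a ∧ H.Adj y a

lemma IsBlocking.card_coNbrs_le (hB : IsBlocking H π F f) {x y : V} (hxy : x ≠ y) :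
    (coNbrs H x y).card ≤ 8 * f + 1 := by
  set N := coNbrs H x y with hN
  let T := (N ×ˢ N).filter fun p => p.2 ∈ endpoints (F s(x, p.1)) ∪ endpoints (F s(y, p.1))
  have hT : T.card ≤ 4 * f * N.card := by
    refine Finset.card_le_mul_card_image_of_maps_to (f := Prod.fst)
      (fun p hp => (Finset.mem_product.1 (Finset.mem_filter.1 hp).1).1) _ fun i _ => ?_
    have hinj : Set.InjOn Prod.snd (↑(T.filter fun p => p.1 = i) : Set (V × V)) := by
      rintro ⟨a, b⟩ ha ⟨c, d⟩ hc h
      simp only [Finset.coe_filter, Set.mem_ofPred_eq] at ha hc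
      exact Prod.ext (ha.2.trans hc.2.symm) h
    rw [← Finset.card_image_of_injOn hinj]
    refine (Finset.card_le_card (t := endpoints (F s(x, i)) ∪ endpoints (F s(y, i))) ?_).trans ?_
    · intro j hj
      obtain ⟨⟨a, b⟩, hp, rfl⟩ := Finset.mem_image.1 hj
      obtain ⟨hpT, rfl⟩ := Finset.mem_filter.1 hp
      exact (Finset.mem_filter.1 hpT).2
    · refine (Finset.card_union_le _ _).trans ?_
      have h1 := card_endpoints_le (F s(x, i))
      have h2 := card_endpoints_le (F s(y, i))
      have h3 := hB.card_le s(x, i)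
      have h4 := hB.card_le s(y, i)
      omega
  have hsub : N.offDiag ⊆ T ∪ T.image Prod.swap := by
    rintro ⟨i, j⟩ hij
    obtain ⟨hi, hj, hne⟩ := Finset.mem_offDiag.1 hij
    have hi' := hi
    have hj' := hj
    simp only [hN, coNbrs, Finset.mem_filter, Finset.mem_univ, true_and] at hi' hj'
    have hmem : (i, j) ∈ T ∨ (j, i) ∈ T := by
      simpa only [T, Finset.mem_filter, Finset.mem_product, hi, hj, true_and] using
        hB.mem_endpoints_or hi'.1 hi'.2 hj'.1 hj'.2 hxy hne
    rcases hmem with h | h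
    · exact Finset.mem_union_left _ h
    · exact Finset.mem_union_right _ (Finset.mem_image.2 ⟨(j, i), h, rfl⟩)
  have h1 := (Finset.card_le_card hsub).trans (Finset.card_union_le _ _)
  have h2 : (T.image Prod.swap).card ≤ T.card := Finset.card_image_le
  rw [Finset.offDiag_card] at h1
  by_contra! hlt
  have h3 : N.card * N.card ≤ 8 * f * N.card + N.card := by
    have : 4 * f * N.card + 4 * f * N.card = 8 * f * N.card := by ring
    omega
  nlinarith

/-- `a` can be attached at `u` to the middle edge `(u, v)` of a middle-heavy, chain-unblocked
path with three edges. -/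
def IsTail (H : SimpleGraph V) (π : Sym2 V → ℕ) (F : Sym2 V → Finset (Sym2 V))
    (u v a : V) : Prop :=
  H.Adj u a ∧ π s(u, a) < π s(u, v) ∧ a ∉ endpoints (F s(u, v))

omit [DecidableRel H.Adj] in
lemma IsTail.notMem {u v a : V} (h : IsTail H π F u v a) (k : V) :
    s(a, k) ∉ F s(u, v) ∧ s(k, a) ∉ F s(u, v) ∧ s(a, k) ∉ F s(v, u) ∧ s(k, a) ∉ F s(v, u) := by
  have h := fun hk => h.2.2 (mem_endpoints.2 ⟨k, hk⟩)
  rw [Sym2.eq_swap (a := k), Sym2.eq_swap (a := v)]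
  exact ⟨h, h, h, h⟩

omit [DecidableRel H.Adj] in
lemma IsBlocking.eq_of_isTail (hB : IsBlocking H π F f) {u v v' b : V} (huv : H.Adj u v)
    (huv' : H.Adj u v') (hb : IsTail H π F v u b) (hb' : IsTail H π F v' u b) : v = v' := by
  by_contra hne
  wlog hlt : π s(u, v') < π s(u, v) generalizing v v'
  · refine this huv' huv hb' hb (Ne.symm hne) (lt_of_le_of_ne (not_lt.1 hlt) fun h => ?_)
    have := hB.inj h
    grind [Sym2.eq_iff]
  have h1 := hb.2.1
  have h2 := hb'.2.1
  have n := hb.notMem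
  rw [Sym2.eq_swap (a := v) (b := u)] at h1
  rw [Sym2.eq_swap (a := v') (b := u), Sym2.eq_swap (a := v') (b := b)] at h2
  rcases (hB.square u v b v' huv hb.1 hb'.1.symm huv'.symm h1 (h2.trans hlt)
    (by rwa [Sym2.eq_swap])).1 with h | h
  · exact (n v).2.2.2 h
  · exact (n v').2.2.1 h

omit [DecidableRel H.Adj] in
lemma IsBlocking.le_of_isTail (hB : IsBlocking H π F f) {u v b : V} (huv : H.Adj u v)
    (hub : H.Adj u b) (hb : IsTail H π F v u b) : π s(u, v) ≤ π s(u, b) := by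
  by_contra! hlt
  have h1 := hb.2.1
  rw [Sym2.eq_swap (a := v) (b := u)] at h1
  rw [Sym2.eq_swap (a := u) (b := b)] at hlt
  exact (hb.notMem v).2.2.2 (hB.triangle u v b huv hb.1 hub.symm h1 hlt)

omit [DecidableRel H.Adj] in
lemma IsBlocking.not_crossing (hB : IsBlocking H π F f) {u v u' a b : V} (huv : H.Adj u v)
    (huu' : H.Adj u u') (ha : IsTail H π F u v a) (hb : IsTail H π F v u b)
    (ha' : IsTail H π F u' u a) (hb' : IsTail H π F u u' b) : False := by
  have h1 := hB.le_of_isTail huv hb'.1 hb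
  have h2 := hB.le_of_isTail huu' ha.1 ha'
  have h3 := ha.2.1
  have h4 := hb'.2.1
  omega

omit [DecidableRel H.Adj] in
lemma IsBlocking.mem_of_meet (hB : IsBlocking H π F f) {u v u' v' a b : V} (huv : H.Adj u v)
    (huv' : H.Adj u' v') (ha : IsTail H π F u v a) (hb : IsTail H π F v u b)
    (ha' : IsTail H π F u' v' a) (hb' : IsTail H π F v' u' b) (hlt : π s(u', v') < π s(u, v)) :
    s(u', v') ∈ F s(u, v) := by
  have h1 := hb.2.1
  have h2 := hb'.2.1
  have h3 := ha'.2.1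
  have h4 := ha.2.1
  rw [Sym2.eq_swap (a := v) (b := u)] at h1
  rw [Sym2.eq_swap (a := v') (b := u'), Sym2.eq_swap (a := v') (b := b)] at h2
  rw [Sym2.eq_swap (a := u) (b := a)] at h4
  rcases hB.hexagon u v b v' u' a huv hb.1 hb'.1.symm huv'.symm ha'.1 ha.1.symm h1
    (h2.trans hlt) (by rwa [Sym2.eq_swap]) (h3.trans hlt) h4 with h | h | h | h | h
  · exact absurd h (hb.notMem v).2.2.2
  · exact absurd h (hb.notMem v').2.2.1
  · rwa [Sym2.eq_swap (a := u')]
  · exact absurd h (ha.notMem u').2.1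
  · exact absurd h (ha.notMem u).1

omit [DecidableRel H.Adj] in
lemma IsBlocking.meet (hB : IsBlocking H π F f) {u v u' v' a b : V} (huv : H.Adj u v)
    (huv' : H.Adj u' v') (ha : IsTail H π F u v a) (hb : IsTail H π F v u b)
    (ha' : IsTail H π F u' v' a) (hb' : IsTail H π F v' u' b) (hne : (u, v) ≠ (u', v')) :
    u ≠ u' ∧ v ≠ v' ∧ (s(u', v') ∈ F s(u, v) ∨ s(u, v) ∈ F s(u', v')) := by
  have hu : u ≠ u' := by
    rintro rfl
    exact hne (Prod.ext rfl (hB.eq_of_isTail huv huv' hb hb'))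
  have hv : v ≠ v' := by
    rintro rfl
    exact hne (Prod.ext (hB.eq_of_isTail huv.symm huv'.symm ha ha') rfl)
  refine ⟨hu, hv, ?_⟩
  rcases lt_trichotomy (π s(u', v')) (π s(u, v)) with h | h | h
  · exact Or.inl (hB.mem_of_meet huv huv' ha hb ha' hb' h)
  · rcases Sym2.eq_iff.1 (hB.inj h) with ⟨h1, -⟩ | ⟨-, rfl⟩
    · exact absurd h1.symm hu
    · exact (hB.not_crossing huv huv'.symm ha hb ha' hb').elim
  · exact Or.inr (hB.mem_of_meet huv' huv ha' hb' ha hb h)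

/-- The ordered pairs of adjacent vertices. -/
def adjPairs (H : SimpleGraph V) [DecidableRel H.Adj] : Finset (V × V) :=
  Finset.univ.filter fun d => H.Adj d.1 d.2

/-- The neighbors of `u` joined to it by an edge preceding `(u, v)`. -/
def earlierNbrs (H : SimpleGraph V) [DecidableRel H.Adj] (π : Sym2 V → ℕ) (u v : V) : Finset V :=
  Finset.univ.filter fun a => H.Adj u a ∧ π s(u, a) < π s(u, v)

lemma card_adjPairs_filter_lt_le (hπ : Function.Injective π) (D : ℕ) :
    ((adjPairs H).filter fun d => (earlierNbrs H π d.1 d.2).card < D).card ≤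
      D * Fintype.card V := by
  refine Finset.card_le_mul_card_image_of_maps_to (f := Prod.fst)
    (t := (Finset.univ : Finset V)) (by simp) D fun u _ => ?_
  refine (Finset.card_le_card_of_injOn (t := Finset.range D)
    (fun d => (earlierNbrs H π d.1 d.2).card) ?_ ?_).trans (Finset.card_range D).le
  · intro d hd
    simp only [Finset.coe_filter, Finset.mem_filter, Set.mem_ofPred_eq] at hd
    simpa using hd.1.2
  · have hlt : ∀ v v', H.Adj u v → π s(u, v) < π s(u, v') →
        (earlierNbrs H π u v).card < (earlierNbrs H π u v').card := by
      intro v v' huv h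
      refine Finset.card_lt_card (Finset.ssubset_iff_of_subset ?_ |>.2 ⟨v, ?_, ?_⟩)
      · intro a ha
        simp only [earlierNbrs, Finset.mem_filter, Finset.mem_univ, true_and] at ha ⊢
        exact ⟨ha.1, ha.2.trans h⟩
      · simp [earlierNbrs, huv, h]
      · simp [earlierNbrs]
    rintro ⟨a, v⟩ hv ⟨b, v'⟩ hv' h
    simp only [adjPairs, Finset.coe_filter, Finset.mem_filter, Finset.mem_univ, true_and,
      Set.mem_ofPred_eq] at hv hv' h
    obtain ⟨⟨hv, -⟩, rfl⟩ := hv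
    obtain ⟨⟨hv', -⟩, rfl⟩ := hv'
    rcases lt_trichotomy (π s(b, v)) (π s(b, v')) with h' | h' | h'
    · exact absurd h (hlt v v' hv h').ne
    · exact Prod.ext rfl (Sym2.congr_right.1 (hπ h'))
    · exact absurd h (hlt v' v hv' h').ne'

open Classical in
/-- The vertices which can be attached at `u` to the middle edge `(u, v)`. -/
noncomputable def tails (H : SimpleGraph V) (π : Sym2 V → ℕ) (F : Sym2 V → Finset (Sym2 V)) (u v : V) :
    Finset V :=
  Finset.univ.filter (IsTail H π F u v)

omit [DecidableRel H.Adj] in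
lemma mem_tails {u v a : V} : a ∈ tails H π F u v ↔ IsTail H π F u v a := by
  simp [tails]

lemma IsBlocking.card_earlierNbrs_le (hB : IsBlocking H π F f) (u v : V) :
    (earlierNbrs H π u v).card ≤ (tails H π F u v).card + 2 * f := by
  have hsub : earlierNbrs H π u v ⊆ tails H π F u v ∪ endpoints (F s(u, v)) := by
    intro a ha
    simp only [earlierNbrs, Finset.mem_filter, Finset.mem_univ, true_and] at ha
    by_cases h : a ∈ endpoints (F s(u, v))
    · exact Finset.mem_union_right _ h
    · exact Finset.mem_union_left _ (mem_tails.2 ⟨ha.1, ha.2, h⟩)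
  have h1 := (Finset.card_le_card hsub).trans (Finset.card_union_le _ _)
  have h2 := card_endpoints_le (F s(u, v))
  have h3 := hB.card_le s(u, v)
  omega

/-- The middle-heavy, chain-unblocked paths with three edges, given by their middle edge and their
endpoints. -/
noncomputable def scumPaths (H : SimpleGraph V) [DecidableRel H.Adj] (π : Sym2 V → ℕ)
    (F : Sym2 V → Finset (Sym2 V)) : Finset (Σ _ : V × V, V × V) :=
  (adjPairs H).sigma fun d => tails H π F d.1 d.2 ×ˢ tails H π F d.2 d.1

lemma IsBlocking.le_card_scumPaths (hB : IsBlocking H π F f) {D : ℕ} (hD : 4 * f ≤ D)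
    (hN : 4 * Fintype.card V * D ≤ (adjPairs H).card) :
    (adjPairs H).card * D ^ 2 ≤ 8 * (scumPaths H π F).card := by
  set A := adjPairs H with hA
  let B := A.filter fun d => (earlierNbrs H π d.1 d.2).card < D
  let g := A.filter fun d => D ≤ (earlierNbrs H π d.1 d.2).card ∧
    D ≤ (earlierNbrs H π d.2 d.1).card
  have hB1 : B.card ≤ D * Fintype.card V := card_adjPairs_filter_lt_le hB.inj D
  have hsub : A ⊆ g ∪ (B ∪ B.image Prod.swap) := by
    rintro ⟨u, v⟩ hd
    have hs : (v, u) ∈ A := by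
      simp only [hA, adjPairs, Finset.mem_filter, Finset.mem_univ, true_and] at hd ⊢
      exact hd.symm
    simp only [g, B, Finset.mem_union, Finset.mem_filter, Finset.mem_image, hd, true_and]
    by_cases h1 : D ≤ (earlierNbrs H π u v).card
    · by_cases h2 : D ≤ (earlierNbrs H π v u).card
      · exact Or.inl ⟨h1, h2⟩
      · exact Or.inr (Or.inr ⟨(v, u), ⟨hs, not_le.1 h2⟩, rfl⟩)
    · exact Or.inr (Or.inl (not_le.1 h1))
  have hg : A.card ≤ 2 * g.card := by
    have h1 := (Finset.card_le_card hsub).trans ((Finset.card_union_le _ _).trans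
      (add_le_add le_rfl (Finset.card_union_le _ _)))
    have h2 : (B.image Prod.swap).card ≤ B.card := Finset.card_image_le
    nlinarith
  have hP : g.card * D ^ 2 ≤ 4 * (scumPaths H π F).card := by
    rw [scumPaths, Finset.card_sigma, Finset.mul_sum, ← smul_eq_mul]
    refine (Finset.card_nsmul_le_sum g
      (fun d => 4 * (tails H π F d.1 d.2 ×ˢ tails H π F d.2 d.1).card) _ fun d hd => ?_).trans
      (Finset.sum_le_sum_of_subset (Finset.filter_subset _ _))
    obtain ⟨-, h1, h2⟩ := Finset.mem_filter.1 hd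
    have h3 := hB.card_earlierNbrs_le d.1 d.2
    have h4 := hB.card_earlierNbrs_le d.2 d.1
    rw [Finset.card_product]
    have h5 : D ≤ 2 * (tails H π F d.1 d.2).card := by omega
    have h6 : D ≤ 2 * (tails H π F d.2 d.1).card := by omega
    nlinarith [Nat.mul_le_mul h5 h6]
  nlinarith

/-- The ordered pairs of paths with the same endpoints such that the middle edge of the second
one is blocked with the middle edge of the first one. -/
noncomputable def blockedMeets (H : SimpleGraph V) [DecidableRel H.Adj] (π : Sym2 V → ℕ)
    (F : Sym2 V → Finset (Sym2 V)) : Finset ((Σ _ : V × V, V × V) × (Σ _ : V × V, V × V)) :=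
  (scumPaths H π F ×ˢ scumPaths H π F).filter fun p =>
    p.1.2 = p.2.2 ∧ p.1.1.1 ≠ p.2.1.1 ∧ p.1.1.2 ≠ p.2.1.2 ∧
      s(p.2.1.1, p.2.1.2) ∈ F s(p.1.1.1, p.1.1.2)

lemma mem_scumPaths {p : Σ _ : V × V, V × V} : p ∈ scumPaths H π F ↔
    H.Adj p.1.1 p.1.2 ∧ IsTail H π F p.1.1 p.1.2 p.2.1 ∧ IsTail H π F p.1.2 p.1.1 p.2.2 := by
  simp [scumPaths, adjPairs, mem_tails]

lemma IsBlocking.card_blockedMeets_le (hB : IsBlocking H π F f) :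
    (blockedMeets H π F).card ≤ (8 * f + 1) ^ 2 * (2 * f * (adjPairs H).card) := by
  let E := (adjPairs H ×ˢ (Finset.univ : Finset (V × V))).filter fun q =>
    s(q.2.1, q.2.2) ∈ F s(q.1.1, q.1.2)
  have hE : E.card ≤ 2 * f * (adjPairs H).card := by
    refine Finset.card_le_mul_card_image_of_maps_to (f := Prod.fst)
      (fun q hq => (Finset.mem_product.1 (Finset.mem_filter.1 hq).1).1) _ fun d _ => ?_
    refine (Finset.card_le_card_of_injOn
      (t := Finset.univ.filter fun p : V × V => s(p.1, p.2) ∈ F s(d.1, d.2)) Prod.snd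
      ?_ ?_).trans ((card_pairs_le _).trans (Nat.mul_le_mul_left 2 (hB.card_le _)))
    · rintro ⟨a, b⟩ hq
      simp only [Finset.coe_filter, Finset.mem_filter, Set.mem_ofPred_eq] at hq ⊢
      obtain ⟨⟨-, h⟩, rfl⟩ := hq
      exact ⟨Finset.mem_univ _, h⟩
    · rintro ⟨a, b⟩ ha ⟨c, d⟩ hc h
      simp only [Finset.coe_filter, Set.mem_ofPred_eq] at ha hc
      exact Prod.ext (ha.2.trans hc.2.symm) h
  refine (Finset.card_le_mul_card_image_of_maps_to (f := fun p => (p.1.1, p.2.1)) (t := E)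
    ?_ ((8 * f + 1) ^ 2) ?_).trans (Nat.mul_le_mul_left _ hE)
  · intro p hp
    obtain ⟨hp, -, -, -, h⟩ := Finset.mem_filter.1 hp
    obtain ⟨h1, -⟩ := Finset.mem_product.1 hp
    exact Finset.mem_filter.2 ⟨Finset.mem_product.2 ⟨(Finset.mem_sigma.1 h1).1,
      Finset.mem_univ _⟩, h⟩
  · rintro ⟨⟨u, v⟩, ⟨u', v'⟩⟩ -
    by_cases hne : u ≠ u' ∧ v ≠ v'
    · refine (Finset.card_le_card_of_injOn (t := coNbrs H u u' ×ˢ coNbrs H v v')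
        (fun p => p.1.2) ?_ ?_).trans ?_
      · rintro ⟨⟨d, c⟩, ⟨d', c'⟩⟩ hp
        simp only [blockedMeets, Finset.coe_filter, Finset.mem_filter, Set.mem_ofPred_eq,
          Finset.mem_product, mem_scumPaths, Prod.mk.injEq] at hp
        obtain ⟨⟨⟨⟨-, h1, h2⟩, -, h3, h4⟩, rfl, -⟩, rfl, rfl⟩ := hp
        simp only [coNbrs, Finset.coe_product, Finset.coe_filter, Set.mem_prod,
          Set.mem_ofPred_eq, Finset.mem_univ, true_and]
        exact ⟨⟨h1.1, h3.1⟩, h2.1, h4.1⟩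
      · rintro ⟨⟨d, c⟩, ⟨d', c'⟩⟩ hp ⟨⟨e, b⟩, ⟨e', b'⟩⟩ hq h
        simp only [blockedMeets, Finset.coe_filter, Finset.mem_filter, Set.mem_ofPred_eq,
          Prod.mk.injEq] at hp hq h
        obtain ⟨⟨-, rfl, -⟩, rfl, rfl⟩ := hp
        obtain ⟨⟨-, rfl, -⟩, rfl, rfl⟩ := hq
        rw [h]
      · rw [Finset.card_product, sq]
        exact Nat.mul_le_mul (hB.card_coNbrs_le hne.1) (hB.card_coNbrs_le hne.2)
    · refine (Finset.card_eq_zero.2 (Finset.filter_eq_empty_iff.2 ?_)).trans_le (Nat.zero_le _)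
      rintro ⟨⟨d, c⟩, ⟨d', c'⟩⟩ hp h
      obtain ⟨-, -, h1, h2, -⟩ := Finset.mem_filter.1 hp
      simp only [Prod.mk.injEq] at h
      obtain ⟨rfl, rfl⟩ := h
      exact hne ⟨h1, h2⟩

lemma IsBlocking.card_scumPaths_sq_le (hB : IsBlocking H π F f) :
    (scumPaths H π F).card ^ 2 ≤ Fintype.card V ^ 2 *
      ((scumPaths H π F).card + 2 * ((8 * f + 1) ^ 2 * (2 * f * (adjPairs H).card))) := by
  have h := card_sq_le_card_mul_card_collisions (scumPaths H π F) Sigma.snd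
  rw [Fintype.card_prod, ← sq] at h
  refine h.trans (Nat.mul_le_mul_left _ ?_)
  refine (Finset.card_le_card (t := (scumPaths H π F).image (fun p => (p, p)) ∪
    (blockedMeets H π F ∪ (blockedMeets H π F).image Prod.swap)) ?_).trans ?_
  · rintro ⟨p, q⟩ hpq
    obtain ⟨hpq, he⟩ := Finset.mem_filter.1 hpq
    obtain ⟨hp, hq⟩ := Finset.mem_product.1 hpq
    have hp' := mem_scumPaths.1 hp
    have hq' := mem_scumPaths.1 hq
    obtain ⟨⟨u, v⟩, c⟩ := p
    obtain ⟨⟨u', v'⟩, c'⟩ := q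
    obtain rfl : c = c' := he
    by_cases hne : (u, v) = (u', v')
    · refine Finset.mem_union_left _ (Finset.mem_image.2 ⟨_, hp, ?_⟩)
      rw [hne]
    · obtain ⟨h1, h2, h3⟩ := hB.meet hp'.1 hq'.1 hp'.2.1 hp'.2.2 hq'.2.1 hq'.2.2 hne
      refine Finset.mem_union_right _ ?_
      rcases h3 with h3 | h3
      · exact Finset.mem_union_left _ (Finset.mem_filter.2
          ⟨Finset.mem_product.2 ⟨hp, hq⟩, rfl, h1, h2, h3⟩)
      · exact Finset.mem_union_right _ (Finset.mem_image.2 ⟨(⟨(u', v'), c⟩, ⟨(u, v), c⟩), Finset.mem_filter.2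
          ⟨Finset.mem_product.2 ⟨hq, hp⟩, rfl, h1.symm, h2.symm, h3⟩, rfl⟩)
  · have h1 : ((scumPaths H π F).image (fun p => (p, p))).card ≤ _ := Finset.card_image_le
    have h2 : ((blockedMeets H π F).image Prod.swap).card ≤ _ := Finset.card_image_le
    have h3 := hB.card_blockedMeets_le
    refine (Finset.card_union_le _ _).trans (add_le_add h1 ?_)
    refine (Finset.card_union_le _ _).trans ?_
    omega

lemma ncard_edgeSet_le_card_adjPairs : H.edgeSet.ncard ≤ (adjPairs H).card := by
  have hsub : H.edgeSet ⊆ ↑((adjPairs H).image fun d => s(d.1, d.2)) := by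
    intro e he
    induction e with | _ x y
    exact Finset.mem_coe.2 (Finset.mem_image.2 ⟨(x, y), by simpa [adjPairs] using he, rfl⟩)
  refine (Set.ncard_le_ncard hsub (Finset.finite_toSet _)).trans ?_
  rw [Set.ncard_coe_finset]
  exact Finset.card_image_le

omit [DecidableEq V] in
lemma IsBlocking.card_adjPairs_le (hB : IsBlocking H π F f) (hf : 0 < f) :
    (adjPairs H).card < 16 * Fintype.card V * f ∨
      (adjPairs H).card ^ 3 ≤ 1024 * Fintype.card V ^ 4 ∨
      (adjPairs H).card ^ 5 ≤ 10 ^ 9 * Fintype.card V ^ 6 * f ^ 3 := by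
  classical
  set n := Fintype.card V with hn
  set N := (adjPairs H).card with hN
  rcases Nat.eq_zero_or_pos n with h0 | hpos
  · have : IsEmpty V := Fintype.card_eq_zero_iff.1 h0
    right; left
    have : N = 0 := by rw [hN]; simp [adjPairs]
    simp [this]
  rcases lt_or_ge (N / (4 * n)) (4 * f) with hlt | hge
  · left
    rw [Nat.div_lt_iff_lt_mul (by omega)] at hlt
    calc N < _ := hlt
      _ = _ := by ring
  right
  set D := N / (4 * n)
  have hND : 4 * n * D ≤ N := Nat.mul_div_le _ _
  have hND' : N ≤ 8 * n * D := by
    have h1 : N < 4 * n * (D + 1) := Nat.lt_mul_div_succ N (by omega)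
    have h2 : 1 ≤ D := by omega
    nlinarith
  have hP := hB.le_card_scumPaths hge hND
  have hM := hB.card_scumPaths_sq_le
  set P := (scumPaths H π F).card
  rw [← hN] at hP hM
  rw [← hn] at hM
  have hK : (8 * f + 1) ^ 2 ≤ 81 * f ^ 2 := by
    calc (8 * f + 1) ^ 2 ≤ (9 * f) ^ 2 := Nat.pow_le_pow_left (by omega) 2
      _ = _ := by ring
  have hM' : P ^ 2 ≤ n ^ 2 * (P + 324 * (N * f ^ 3)) := by
    refine hM.trans (Nat.mul_le_mul_left _ (Nat.add_le_add_left ?_ _))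
    calc _ ≤ 2 * (81 * f ^ 2 * (2 * f * N)) := by gcongr
      _ = _ := by ring
  rcases Nat.eq_zero_or_pos N with hN0 | hNpos
  · left; simp [hN0]
  rcases le_or_gt P (2 * n ^ 2) with hle | hgt
  · left
    calc N ^ 3 = N * N ^ 2 := by ring
      _ ≤ N * (8 * n * D) ^ 2 := by gcongr
      _ = 64 * n ^ 2 * (N * D ^ 2) := by ring
      _ ≤ 64 * n ^ 2 * (8 * P) := by gcongr
      _ ≤ 64 * n ^ 2 * (8 * (2 * n ^ 2)) := by gcongr
      _ = _ := by ring
  · right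
    have h1 : P ^ 2 ≤ 648 * n ^ 2 * N * f ^ 3 := by nlinarith
    have h2 : N * D ^ 4 ≤ 41472 * n ^ 2 * f ^ 3 := by
      refine le_of_mul_le_mul_left (a := N) ?_ hNpos
      calc N * (N * D ^ 4) = (N * D ^ 2) ^ 2 := by ring
        _ ≤ (8 * P) ^ 2 := by gcongr
        _ = 64 * P ^ 2 := by ring
        _ ≤ 64 * (648 * n ^ 2 * N * f ^ 3) := by gcongr
        _ = _ := by ring
    calc N ^ 5 = N * N ^ 4 := by ring
      _ ≤ N * (8 * n * D) ^ 4 := by gcongr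
      _ = 4096 * n ^ 4 * (N * D ^ 4) := by ring
      _ ≤ 4096 * n ^ 4 * (41472 * n ^ 2 * f ^ 3) := by gcongr
      _ = 169869312 * n ^ 6 * f ^ 3 := by ring
      _ ≤ 10 ^ 9 * n ^ 6 * f ^ 3 := by gcongr; norm_num

end Counting

lemma le_hundred_mul_of_bounds {N n f : ℕ}
    (h : N < 16 * n * f ∨ N ^ 3 ≤ 1024 * n ^ 4 ∨ N ^ 5 ≤ 10 ^ 9 * n ^ 6 * f ^ 3) :
    (N : ℝ) ≤ 100 * ((n : ℝ) ^ ((4 : ℝ) / 3) + (n : ℝ) ^ ((6 : ℝ) / 5) * (f : ℝ) ^ ((3 : ℝ) / 5)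
      + (n : ℝ) * (f : ℝ)) := by
  have a0 : 0 ≤ (n : ℝ) ^ ((4 : ℝ) / 3) := by positivity
  have b0 : 0 ≤ (n : ℝ) ^ ((6 : ℝ) / 5) * (f : ℝ) ^ ((3 : ℝ) / 5) := by positivity
  have c0 : 0 ≤ (n : ℝ) * f := by positivity
  rcases h with h | h | h
  · have h' : (N : ℝ) ≤ 16 * n * f := by exact_mod_cast h.le
    nlinarith
  · have h' : (N : ℝ) ^ 3 ≤ 1024 * (n : ℝ) ^ 4 := by exact_mod_cast h
    have h3 : ((n : ℝ) ^ ((4 : ℝ) / 3)) ^ 3 = (n : ℝ) ^ 4 := by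
      rw [← Real.rpow_mul_natCast (by positivity),
        show (4 : ℝ) / 3 * (3 : ℕ) = (4 : ℕ) by norm_num, Real.rpow_natCast]
    have : (N : ℝ) ≤ 100 * (n : ℝ) ^ ((4 : ℝ) / 3) := by
      refine le_of_pow_le_pow_left₀ (n := 3) (by norm_num) (by positivity) ?_
      rw [mul_pow, h3]
      have : 0 ≤ (n : ℝ) ^ 4 := by positivity
      nlinarith
    linarith
  · have h' : (N : ℝ) ^ 5 ≤ 10 ^ 9 * (n : ℝ) ^ 6 * (f : ℝ) ^ 3 := by exact_mod_cast h
    have h3 : ((n : ℝ) ^ ((6 : ℝ) / 5)) ^ 5 = (n : ℝ) ^ 6 := by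
      rw [← Real.rpow_mul_natCast (by positivity),
        show (6 : ℝ) / 5 * (5 : ℕ) = (6 : ℕ) by norm_num, Real.rpow_natCast]
    have h4 : ((f : ℝ) ^ ((3 : ℝ) / 5)) ^ 5 = (f : ℝ) ^ 3 := by
      rw [← Real.rpow_mul_natCast (by positivity),
        show (3 : ℝ) / 5 * (5 : ℕ) = (3 : ℕ) by norm_num, Real.rpow_natCast]
    have : (N : ℝ) ≤ 100 * ((n : ℝ) ^ ((6 : ℝ) / 5) * (f : ℝ) ^ ((3 : ℝ) / 5)) := by
      refine le_of_pow_le_pow_left₀ (n := 5) (by norm_num) (by positivity) ?_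
      rw [mul_pow, mul_pow, h3, h4]
      have : 0 ≤ (n : ℝ) ^ 6 * (f : ℝ) ^ 3 := by positivity
      nlinarith
    linarith

/-- There is an absolute constant `C > 0` such that for every positive
integer `f` and every weighted graph `G` on `n` vertices, there exists an `f`-EFT
`5`-emulator `H` of `G` with `|E(H)| ≤ C·(n^{4/3} + n^{6/5}·f^{3/5} + n·f)`. -/
theorem statement_0 :
    ∃ C : ℝ, 0 < C ∧
      ∀ (f : ℕ), 0 < f →
        ∀ (V : Type) [Fintype V], ∀ (G : SimpleGraph V) (w : Sym2 V → ℝ≥0∞),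
          (∀ e ∈ G.edgeSet, 0 < w e ∧ w e ≠ ⊤) →
          ∃ H : SimpleGraph V,
            IsEFTEmulator G w H f 5 ∧
            (H.edgeSet.ncard : ℝ) ≤
              C * ((Fintype.card V : ℝ) ^ ((4 : ℝ) / 3)
                + (Fintype.card V : ℝ) ^ ((6 : ℝ) / 5) * (f : ℝ) ^ ((3 : ℝ) / 5)
                + (Fintype.card V : ℝ) * (f : ℝ)) := by
  classical
  refine ⟨100, by norm_num, fun f hf V _ G w _ => ?_⟩
  obtain ⟨π, hinj, hmono⟩ := exists_injective_rank w
  obtain ⟨F, hB⟩ := exists_isBlocking_greedyEmulator (G := G) (f := f) hinj hmono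
  refine ⟨greedyEmulator G w f π, isEFTEmulator_greedyEmulator, ?_⟩
  exact (Nat.cast_le.2 ncard_edgeSet_le_card_adjPairs).trans
    (le_hundred_mul_of_bounds (hB.card_adjPairs_le hf))
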